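/- The glued path-recording operator is close to the composition of three path-recording operators. There is a universal constant C > 0 such that for all n, λ, t ∈ ℕ, ‖ (V^{glued} − V³ V² V¹) · Π_{≤t} ‖_op ≤ C · t² / 2^{λ}. -/

import Mathlib

noncomputable section
open MeasureTheory Matrix
open scoped ComplexOrder

/-- `n`-bit strings, indexing the computational basis of an `n`-qubit register. -/
abbrev BS (n : ℕ) := Fin n → Bool

/-- ℓ²-space with orthonormal basis indexed by `ι`. -/
abbrev QState (ι : Type) := lp (fun _ : ι => ℂ) 2

/-- basis vector (ket) labelled by `i`. -/
def ket {ι : Type} (i : ι) : QState ι :=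
  letI := Classical.decEq ι
  lp.single 2 i 1

/-- inverse of a relation. -/
def dbInv {σ : Type} (R : Multiset (σ × σ)) : Multiset (σ × σ) := R.map fun p => (p.2, p.1)

/-- image (set of second coordinates) of a relation. -/
def dbIm {σ : Type} [DecidableEq σ] (R : Multiset (σ × σ)) : Finset σ :=
  (R.map Prod.snd).toFinset

/-- The index set of the computational basis of the purified space for the
gluing construction (without auxiliary register): the query registers
`A ⊗ B ⊗ C` together with the six relation databases
`(L₁,R₁), (L₂,R₂), (L₃,R₃)`; systems 1 and 3 record relations on `AB`-labels
and system 2 records relations on `BC`-labels. -/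
abbrev GluedIdx (n lam : ℕ) :=
  (BS n × BS lam × BS n) ×
    ((Multiset ((BS n × BS lam) × (BS n × BS lam)) ×
      Multiset ((BS n × BS lam) × (BS n × BS lam))) ×
     (Multiset ((BS lam × BS n) × (BS lam × BS n)) ×
      Multiset ((BS lam × BS n) × (BS lam × BS n))) ×
     (Multiset ((BS n × BS lam) × (BS n × BS lam)) ×
      Multiset ((BS n × BS lam) × (BS n × BS lam))))

/-- operators on the purified space. -/
abbrev GOp (n lam : ℕ) := QState (GluedIdx n lam) →L[ℂ] QState (GluedIdx n lam)

/-- `V` is the left path-recording operator of system 1 (acting on registers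
`A,B` and the databases `S₁ = L₁`, `T₁ = R₁`). -/
def IsVL1 {n lam : ℕ} (V : GOp n lam) : Prop :=
  ∀ (a : BS n) (b : BS lam) (c : BS n)
    (L1 R1 : Multiset ((BS n × BS lam) × (BS n × BS lam)))
    (L2 R2 : Multiset ((BS lam × BS n) × (BS lam × BS n)))
    (L3 R3 : Multiset ((BS n × BS lam) × (BS n × BS lam))),
    V (ket ((a, b, c), ((L1, R1), (L2, R2), (L3, R3)))) =
      (↑(Real.sqrt ((2 : ℝ) ^ (n + lam) - (dbIm (L1 + dbInv R1)).card)) : ℂ)⁻¹ •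
        ∑ y ∈ (dbIm (L1 + dbInv R1))ᶜ,
          ket ((y.1, y.2, c), ((((a, b), y) ::ₘ L1, R1), (L2, R2), (L3, R3)))

/-- `V` is the right path-recording operator of system 1. -/
def IsVR1 {n lam : ℕ} (V : GOp n lam) : Prop :=
  ∀ (a : BS n) (b : BS lam) (c : BS n)
    (L1 R1 : Multiset ((BS n × BS lam) × (BS n × BS lam)))
    (L2 R2 : Multiset ((BS lam × BS n) × (BS lam × BS n)))
    (L3 R3 : Multiset ((BS n × BS lam) × (BS n × BS lam))),
    V (ket ((a, b, c), ((L1, R1), (L2, R2), (L3, R3)))) =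
      (↑(Real.sqrt ((2 : ℝ) ^ (n + lam) - (dbIm (R1 + dbInv L1)).card)) : ℂ)⁻¹ •
        ∑ y ∈ (dbIm (R1 + dbInv L1))ᶜ,
          ket ((y.1, y.2, c), ((L1, ((a, b), y) ::ₘ R1), (L2, R2), (L3, R3)))

/-- `V` is the left path-recording operator of system 2 (acting on registers
`B,C` and the databases `S₂ = L₂`, `T₂ = R₂`). -/
def IsVL2 {n lam : ℕ} (V : GOp n lam) : Prop :=
  ∀ (a : BS n) (b : BS lam) (c : BS n)
    (L1 R1 : Multiset ((BS n × BS lam) × (BS n × BS lam)))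
    (L2 R2 : Multiset ((BS lam × BS n) × (BS lam × BS n)))
    (L3 R3 : Multiset ((BS n × BS lam) × (BS n × BS lam))),
    V (ket ((a, b, c), ((L1, R1), (L2, R2), (L3, R3)))) =
      (↑(Real.sqrt ((2 : ℝ) ^ (n + lam) - (dbIm (L2 + dbInv R2)).card)) : ℂ)⁻¹ •
        ∑ y ∈ (dbIm (L2 + dbInv R2))ᶜ,
          ket ((a, y.1, y.2), ((L1, R1), (((b, c), y) ::ₘ L2, R2), (L3, R3)))

/-- `V` is the right path-recording operator of system 2. -/
def IsVR2 {n lam : ℕ} (V : GOp n lam) : Prop :=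
  ∀ (a : BS n) (b : BS lam) (c : BS n)
    (L1 R1 : Multiset ((BS n × BS lam) × (BS n × BS lam)))
    (L2 R2 : Multiset ((BS lam × BS n) × (BS lam × BS n)))
    (L3 R3 : Multiset ((BS n × BS lam) × (BS n × BS lam))),
    V (ket ((a, b, c), ((L1, R1), (L2, R2), (L3, R3)))) =
      (↑(Real.sqrt ((2 : ℝ) ^ (n + lam) - (dbIm (R2 + dbInv L2)).card)) : ℂ)⁻¹ •
        ∑ y ∈ (dbIm (R2 + dbInv L2))ᶜ,
          ket ((a, y.1, y.2), ((L1, R1), (L2, ((b, c), y) ::ₘ R2), (L3, R3)))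

/-- `V` is the left path-recording operator of system 3 (acting on registers
`A,B` and the databases `S₃ = L₃`, `T₃ = R₃`). -/
def IsVL3 {n lam : ℕ} (V : GOp n lam) : Prop :=
  ∀ (a : BS n) (b : BS lam) (c : BS n)
    (L1 R1 : Multiset ((BS n × BS lam) × (BS n × BS lam)))
    (L2 R2 : Multiset ((BS lam × BS n) × (BS lam × BS n)))
    (L3 R3 : Multiset ((BS n × BS lam) × (BS n × BS lam))),
    V (ket ((a, b, c), ((L1, R1), (L2, R2), (L3, R3)))) =
      (↑(Real.sqrt ((2 : ℝ) ^ (n + lam) - (dbIm (L3 + dbInv R3)).card)) : ℂ)⁻¹ •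
        ∑ y ∈ (dbIm (L3 + dbInv R3))ᶜ,
          ket ((y.1, y.2, c), ((L1, R1), (L2, R2), (((a, b), y) ::ₘ L3, R3)))

/-- `V` is the right path-recording operator of system 3. -/
def IsVR3 {n lam : ℕ} (V : GOp n lam) : Prop :=
  ∀ (a : BS n) (b : BS lam) (c : BS n)
    (L1 R1 : Multiset ((BS n × BS lam) × (BS n × BS lam)))
    (L2 R2 : Multiset ((BS lam × BS n) × (BS lam × BS n)))
    (L3 R3 : Multiset ((BS n × BS lam) × (BS n × BS lam))),
    V (ket ((a, b, c), ((L1, R1), (L2, R2), (L3, R3)))) =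
      (↑(Real.sqrt ((2 : ℝ) ^ (n + lam) - (dbIm (R3 + dbInv L3)).card)) : ℂ)⁻¹ •
        ∑ y ∈ (dbIm (R3 + dbInv L3))ᶜ,
          ket ((y.1, y.2, c), ((L1, R1), (L2, R2), (L3, ((a, b), y) ::ₘ R3)))

/-- `P` is the orthogonal projection onto the span of basis states whose six
databases have total size at most `t`. -/
def IsPt {n lam : ℕ} (t : ℕ) (P : GOp n lam) : Prop :=
  ∀ (x : BS n × BS lam × BS n)
    (L1 R1 : Multiset ((BS n × BS lam) × (BS n × BS lam)))
    (L2 R2 : Multiset ((BS lam × BS n) × (BS lam × BS n)))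
    (L3 R3 : Multiset ((BS n × BS lam) × (BS n × BS lam))),
    P (ket (x, ((L1, R1), (L2, R2), (L3, R3)))) =
      if Multiset.card L1 + Multiset.card R1 + Multiset.card L2 + Multiset.card R2 +
          Multiset.card L3 + Multiset.card R3 ≤ t then
        ket (x, ((L1, R1), (L2, R2), (L3, R3)))
      else 0

/-- the combined path-recording operator
`V = V_L (I − V_R V_R†) + (I − V_L V_L†) V_R†`. -/
def prV {E : Type*} [NormedAddCommGroup E] [InnerProductSpace ℂ E] [CompleteSpace E]
    (VL VR : E →L[ℂ] E) : E →L[ℂ] E :=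
  VL * (1 - VR * ContinuousLinearMap.adjoint VR) +
    (1 - VL * ContinuousLinearMap.adjoint VL) * ContinuousLinearMap.adjoint VR

/-- The glued path-recording operator
`V^{glued} = Π^{L,321} V_L³ V_L² V_L¹ (I − Π^{R,1})
  + (Π^{L,32} − Π^{L,321}) V_L³ V_L² V_R^{1,†} (Π^{R,1} − Π^{R,12})
  + (Π^{L,3} − Π^{L,32}) V_L³ V_R^{2,†} V_R^{1,†} (Π^{R,12} − Π^{R,123})
  + (I − Π^{L,3}) V_R^{3,†} V_R^{2,†} V_R^{1,†} Π^{R,123}`. -/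
def gluedOp {E : Type*} [NormedAddCommGroup E] [InnerProductSpace ℂ E] [CompleteSpace E]
    (VL1 VR1 VL2 VR2 VL3 VR3 : E →L[ℂ] E) : E →L[ℂ] E :=
  let dag : (E →L[ℂ] E) → (E →L[ℂ] E) := fun T => ContinuousLinearMap.adjoint T
  let PR1 := VR1 * dag VR1
  let PR12 := VR1 * VR2 * dag VR2 * dag VR1
  let PR123 := VR1 * VR2 * VR3 * dag VR3 * dag VR2 * dag VR1
  let PL3 := VL3 * dag VL3
  let PL32 := VL3 * VL2 * dag VL2 * dag VL3
  let PL321 := VL3 * VL2 * VL1 * dag VL1 * dag VL2 * dag VL3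
  PL321 * (VL3 * VL2 * VL1) * (1 - PR1)
    + (PL32 - PL321) * (VL3 * VL2 * dag VR1) * (PR1 - PR12)
    + (PL3 - PL32) * (VL3 * dag VR2 * dag VR1) * (PR12 - PR123)
    + (1 - PL3) * (dag VR3 * dag VR2 * dag VR1) * PR123

/-! ### Branching operators on `ℓ²(ι)` -/

theorem inner_ket_left {ι : Type} (i : ι) (ψ : QState ι) : inner ℂ (ket i) ψ = ψ i := by
  classical
  simp [ket, lp.inner_single_left]

theorem ket_apply_self {ι : Type} (i : ι) : (ket i : QState ι) i = 1 := by
  simp [ket]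

theorem ket_apply_of_ne {ι : Type} {i j : ι} (h : j ≠ i) : (ket i : QState ι) j = 0 := by
  simp [ket, lp.single_apply, h]

/-- The vectors of `ℓ²(ι)` whose coordinates vanish outside of `S`. -/
def supportedOn {ι : Type} (S : Set ι) : Submodule ℂ (QState ι) where
  carrier := {ψ | ∀ i, i ∉ S → ψ i = 0}
  zero_mem' := fun _ _ => rfl
  add_mem' := fun {x y} hx hy i hi => by simp [hx i hi, hy i hi]
  smul_mem' := fun c x hx i hi => by simp [hx i hi]

theorem sum_sq_coord_le {ι : Type} (ψ : QState ι) (F : Finset ι) :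
    ∑ i ∈ F, ‖ψ i‖ ^ 2 ≤ ‖ψ‖ ^ 2 := by
  have h := lp.sum_rpow_le_norm_rpow (p := 2) (by norm_num) ψ F
  simpa using h

theorem norm_sq_le_of_sum_coord_le {ι : Type} (ψ : QState ι) {K : ℝ}
    (h : ∀ F : Finset ι, ∑ i ∈ F, ‖ψ i‖ ^ 2 ≤ K) : ‖ψ‖ ^ 2 ≤ K := by
  have h0 := lp.hasSum_norm (p := 2) (by norm_num) ψ
  simp only [ENNReal.toReal_ofNat, Real.rpow_ofNat] at h0
  exact hasSum_le_of_sum_le h0 h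

/-- `V` sends each basis vector `i` to `a i` times the sum of the basis vectors in `ch i`, where
the sets of children `ch i` are disjoint and each image has norm at most one. -/
structure IsBranching {ι : Type} (V : QState ι →L[ℂ] QState ι) (a : ι → ℝ)
    (ch : ι → Finset ι) : Prop where
  apply_ket : ∀ i, V (ket i) = (a i : ℂ) • ∑ m ∈ ch i, ket m
  parent_unique : ∀ {i j m : ι}, m ∈ ch i → m ∈ ch j → i = j
  weight_le : ∀ i, a i ^ 2 * (ch i).card ≤ 1

namespace IsBranching

variable {ι : Type} {V : QState ι →L[ℂ] QState ι} {a : ι → ℝ} {ch : ι → Finset ι}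

theorem adjoint_apply (hV : IsBranching V a ch) (ψ : QState ι) (i : ι) :
    (ContinuousLinearMap.adjoint V ψ) i = a i * ∑ m ∈ ch i, ψ m := by
  rw [← inner_ket_left i (ContinuousLinearMap.adjoint V ψ),
    ContinuousLinearMap.adjoint_inner_right, hV.apply_ket, inner_smul_left, sum_inner]
  simp [inner_ket_left]

theorem apply_eq_inner (V : QState ι →L[ℂ] QState ι) (ψ : QState ι) (m : ι) :
    (V ψ) m = inner ℂ (ContinuousLinearMap.adjoint V (ket m)) ψ := by
  rw [← inner_ket_left m (V ψ), ContinuousLinearMap.adjoint_inner_left]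

theorem apply_of_mem (hV : IsBranching V a ch) (ψ : QState ι) {i m : ι} (h : m ∈ ch i) :
    (V ψ) m = a i * ψ i := by
  have key : ContinuousLinearMap.adjoint V (ket m) = (a i : ℂ) • ket i := by
    ext j
    rw [hV.adjoint_apply]
    by_cases hj : j = i
    · subst hj
      have hsum : ∑ b ∈ ch j, (ket m : QState ι) b = (ket m : QState ι) m :=
        Finset.sum_eq_single_of_mem m h fun b _ hb => ket_apply_of_ne hb
      rw [hsum, lp.coeFn_smul, Pi.smul_apply, ket_apply_self, smul_eq_mul, ket_apply_self]
    · have hsum : ∑ b ∈ ch j, (ket m : QState ι) b = 0 :=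
        Finset.sum_eq_zero fun b hb => ket_apply_of_ne fun hbm =>
          hj (hV.parent_unique (hbm ▸ hb) h)
      rw [hsum, lp.coeFn_smul, Pi.smul_apply, ket_apply_of_ne hj, smul_zero, mul_zero]
  rw [apply_eq_inner, key, inner_smul_left, inner_ket_left]
  simp

theorem apply_of_not_mem (hV : IsBranching V a ch) (ψ : QState ι) {m : ι}
    (h : ∀ i, m ∉ ch i) : (V ψ) m = 0 := by
  have key : ContinuousLinearMap.adjoint V (ket m) = 0 := by
    ext j
    have hsum : ∑ b ∈ ch j, (ket m : QState ι) b = 0 :=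
      Finset.sum_eq_zero fun b hb => ket_apply_of_ne fun hbm => h j (hbm ▸ hb)
    rw [hV.adjoint_apply, hsum]
    simp
  rw [apply_eq_inner, key, inner_zero_left]

theorem exists_parent (hV : IsBranching V a ch) {ψ : QState ι} {m : ι} (h : (V ψ) m ≠ 0) :
    ∃ i, m ∈ ch i ∧ ψ i ≠ 0 := by
  by_contra! hn
  by_cases hm : ∃ i, m ∈ ch i
  · obtain ⟨i, hi⟩ := hm
    exact h (by rw [hV.apply_of_mem ψ hi, hn i hi, mul_zero])
  · exact h (hV.apply_of_not_mem ψ (by simpa using hm))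

open Classical in
theorem sum_sq_le (hV : IsBranching V a ch) (ψ : QState ι) (F : Finset ι) {K : ℝ} (hK : 0 ≤ K)
    (hF : ∀ i, (∃ m ∈ F, m ∈ ch i) → a i ^ 2 * ({m ∈ ch i | m ∈ F}.card : ℝ) ≤ K) :
    ∑ m ∈ F, ‖(V ψ) m‖ ^ 2 ≤ K * ‖ψ‖ ^ 2 := by
  let par : ι → ι := fun m => if h : ∃ i, m ∈ ch i then h.choose else m
  have hpar : ∀ {i m}, m ∈ ch i → par m = i := fun {i m} h => by
    have hex : ∃ i, m ∈ ch i := ⟨i, h⟩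
    simp only [par, dif_pos hex]
    exact hV.parent_unique hex.choose_spec h
  have fiber : ∀ i, ∑ m ∈ F with par m = i, ‖(V ψ) m‖ ^ 2 ≤ K * ‖ψ i‖ ^ 2 := by
    intro i
    have h1 : ∑ m ∈ F with par m = i, ‖(V ψ) m‖ ^ 2 = ∑ m ∈ ch i with m ∈ F, ‖(V ψ) m‖ ^ 2 := by
      symm
      apply Finset.sum_subset
      · intro m hm
        simp only [Finset.mem_filter] at hm ⊢
        exact ⟨hm.2, hpar hm.1⟩
      · intro m hm hm'
        simp only [Finset.mem_filter, not_and] at hm hm'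
        rw [hV.apply_of_not_mem]
        · simp
        · intro j hj
          have : j = i := (hpar hj).symm.trans hm.2
          exact hm' (this ▸ hj) hm.1
    have h2 : ∑ m ∈ ch i with m ∈ F, ‖(V ψ) m‖ ^ 2
        = a i ^ 2 * ({m ∈ ch i | m ∈ F}.card : ℝ) * ‖ψ i‖ ^ 2 := by
      rw [Finset.sum_congr rfl fun m hm => by
        rw [hV.apply_of_mem ψ (Finset.mem_filter.1 hm).1]]
      simp [mul_pow]
      ring
    rw [h1, h2]
    by_cases hex : ∃ m ∈ F, m ∈ ch i
    · exact mul_le_mul_of_nonneg_right (hF i hex) (by positivity)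
    · have : ({m ∈ ch i | m ∈ F} : Finset ι) = ∅ := by
        push Not at hex
        exact Finset.filter_eq_empty_iff.2 fun m hm hmF => hex m hmF hm
      rw [this]
      simp
      positivity
  calc ∑ m ∈ F, ‖(V ψ) m‖ ^ 2
      = ∑ i ∈ F.image par, ∑ m ∈ F with par m = i, ‖(V ψ) m‖ ^ 2 :=
        (Finset.sum_fiberwise_of_maps_to (fun m hm => Finset.mem_image_of_mem par hm) _).symm
    _ ≤ ∑ i ∈ F.image par, K * ‖ψ i‖ ^ 2 := Finset.sum_le_sum fun i _ => fiber i
    _ ≤ K * ‖ψ‖ ^ 2 := by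
        rw [← Finset.mul_sum]
        exact mul_le_mul_of_nonneg_left (sum_sq_coord_le ψ _) hK

theorem norm_le_one (hV : IsBranching V a ch) : ‖V‖ ≤ 1 := by
  classical
  refine ContinuousLinearMap.opNorm_le_bound _ zero_le_one fun ψ => ?_
  have h : ‖V ψ‖ ^ 2 ≤ 1 * ‖ψ‖ ^ 2 := norm_sq_le_of_sum_coord_le _ fun F =>
    hV.sum_sq_le ψ F zero_le_one fun i _ => by
      refine le_trans ?_ (hV.weight_le i)
      gcongr
      exact Finset.filter_subset _ _
  rw [one_mul] at h ⊢
  exact le_of_sq_le_sq h (norm_nonneg _)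

theorem adjoint_apply_self (hV : IsBranching V a ch) {S : Set ι}
    (hS : ∀ i ∈ S, a i ^ 2 * (ch i).card = 1) {ψ : QState ι} (hψ : ψ ∈ supportedOn S) :
    ContinuousLinearMap.adjoint V (V ψ) = ψ := by
  ext i
  have hsum : ∑ m ∈ ch i, (V ψ) m = ∑ _m ∈ ch i, a i * ψ i :=
    Finset.sum_congr rfl fun m hm => hV.apply_of_mem ψ hm
  rw [hV.adjoint_apply, hsum]
  by_cases hi : i ∈ S
  · have h : ((a i : ℂ) ^ 2 * (ch i).card) = 1 := by exact_mod_cast hS i hi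
    rw [Finset.sum_const, nsmul_eq_mul]
    linear_combination ψ i * h
  · simp [hψ i hi]

theorem apply_mem (hV : IsBranching V a ch) {S : Set ι}
    (hS : ∀ i, ∀ m ∈ ch i, i ∈ S → m ∈ S) {ψ : QState ι} (hψ : ψ ∈ supportedOn S) :
    V ψ ∈ supportedOn S := by
  intro m hm
  by_contra h
  obtain ⟨i, hi, h0⟩ := hV.exists_parent h
  exact h0 (hψ i fun hiS => hm (hS i m hi hiS))

theorem adjoint_apply_mem (hV : IsBranching V a ch) {S : Set ι}
    (hS : ∀ i, ∀ m ∈ ch i, m ∈ S → i ∈ S) {ψ : QState ι} (hψ : ψ ∈ supportedOn S) :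
    ContinuousLinearMap.adjoint V ψ ∈ supportedOn S := by
  intro i hi
  rw [hV.adjoint_apply, Finset.sum_eq_zero fun m hm => hψ m fun hmS => hi (hS i m hm hmS),
    mul_zero]

theorem apply_adjoint_apply_mem (hV : IsBranching V a ch) {S : Set ι}
    (hS : ∀ i, ∀ m ∈ ch i, ∀ m' ∈ ch i, m ∈ S → m' ∈ S) {ψ : QState ι}
    (hψ : ψ ∈ supportedOn S) :
    V (ContinuousLinearMap.adjoint V ψ) ∈ supportedOn S := by
  intro m hm
  by_contra h
  obtain ⟨i, hi, h0⟩ := hV.exists_parent h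
  refine h0 ?_
  rw [hV.adjoint_apply, Finset.sum_eq_zero fun m' hm' => hψ m' fun hS' =>
    hm (hS i m' hm' m hi hS'), mul_zero]

open Classical in
/-- A Schur-type bound for `R† L`, counting the basis vectors reached by both `L` and `R`. -/
theorem norm_adjoint_apply_le {L R : QState ι →L[ℂ] QState ι} {aL aR : ι → ℝ}
    {chL chR : ι → Finset ι} (hL : IsBranching L aL chL) (hR : IsBranching R aR chR)
    {S : Set ι} {A B c : ℝ} (hA0 : 0 ≤ A) (hB0 : 0 ≤ B) (hc : 0 ≤ c)
    (haL : ∀ i ∈ S, aL i ^ 2 ≤ c)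
    (hA : ∀ i ∈ S, ({m ∈ chL i | ∃ j, m ∈ chR j}.card : ℝ) ≤ A)
    (haR : ∀ j, ∀ m ∈ chR j, (∃ i ∈ S, m ∈ chL i) → aR j ^ 2 ≤ c)
    (hB : ∀ j, ∀ m ∈ chR j, (∃ i ∈ S, m ∈ chL i) →
      ({m ∈ chR j | ∃ i ∈ S, m ∈ chL i}.card : ℝ) ≤ B)
    {ψ : QState ι} (hψ : ψ ∈ supportedOn S) :
    ‖ContinuousLinearMap.adjoint R (L ψ)‖ ≤ c * Real.sqrt (A * B) * ‖ψ‖ := by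
  set χ := ContinuousLinearMap.adjoint R (L ψ) with hχ
  have hsum : ∀ F : Finset ι, ∑ m ∈ F, ‖inner ℂ ((R χ) m) ((L ψ) m)‖
      ≤ c * Real.sqrt (A * B) * ‖ψ‖ * ‖χ‖ := by
    intro F
    let F' : Finset ι := {m ∈ F | (∃ j, m ∈ chR j) ∧ ∃ i ∈ S, m ∈ chL i}
    have h1 : ∑ m ∈ F', ‖inner ℂ ((R χ) m) ((L ψ) m)‖
        = ∑ m ∈ F, ‖inner ℂ ((R χ) m) ((L ψ) m)‖ := by
      refine Finset.sum_subset (Finset.filter_subset _ _) fun m hm hm' => ?_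
      by_contra h
      have hRm : (R χ) m ≠ 0 := fun h0 => h (by simp [h0])
      have hLm : (L ψ) m ≠ 0 := fun h0 => h (by simp [h0])
      obtain ⟨j, hj, -⟩ := hR.exists_parent hRm
      obtain ⟨i, hi, hi0⟩ := hL.exists_parent hLm
      have hiS : i ∈ S := by
        by_contra hiS
        exact hi0 (hψ i hiS)
      exact hm' (Finset.mem_filter.2 ⟨hm, ⟨j, hj⟩, i, hiS, hi⟩)
    have hLs : ∑ m ∈ F', ‖(L ψ) m‖ ^ 2 ≤ c * A * ‖ψ‖ ^ 2 := by
      refine hL.sum_sq_le ψ F' (by positivity) ?_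
      rintro i ⟨m, hm, hmi⟩
      obtain ⟨-, -, i', hi', hmi'⟩ := Finset.mem_filter.1 hm
      have hiS : i ∈ S := hL.parent_unique hmi' hmi ▸ hi'
      refine mul_le_mul (haL i hiS) (le_trans ?_ (hA i hiS)) (by positivity) hc
      refine Nat.cast_le.2 (Finset.card_le_card fun x hx => ?_)
      obtain ⟨hx, hxF⟩ := Finset.mem_filter.1 hx
      exact Finset.mem_filter.2 ⟨hx, (Finset.mem_filter.1 hxF).2.1⟩
    have hRs : ∑ m ∈ F', ‖(R χ) m‖ ^ 2 ≤ c * B * ‖χ‖ ^ 2 := by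
      refine hR.sum_sq_le χ F' (by positivity) ?_
      rintro j ⟨m, hm, hmj⟩
      have hmS := (Finset.mem_filter.1 hm).2.2
      refine mul_le_mul (haR j m hmj hmS) (le_trans ?_ (hB j m hmj hmS)) (by positivity) hc
      refine Nat.cast_le.2 (Finset.card_le_card fun x hx => ?_)
      obtain ⟨hx, hxF⟩ := Finset.mem_filter.1 hx
      exact Finset.mem_filter.2 ⟨hx, (Finset.mem_filter.1 hxF).2.2⟩
    rw [← h1]
    calc ∑ m ∈ F', ‖inner ℂ ((R χ) m) ((L ψ) m)‖
        ≤ ∑ m ∈ F', ‖(R χ) m‖ * ‖(L ψ) m‖ :=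
          Finset.sum_le_sum fun m _ => norm_inner_le_norm _ _
      _ ≤ Real.sqrt (∑ m ∈ F', ‖(R χ) m‖ ^ 2) * Real.sqrt (∑ m ∈ F', ‖(L ψ) m‖ ^ 2) :=
          Real.sum_mul_le_sqrt_mul_sqrt _ _ _
      _ ≤ Real.sqrt (c * B * ‖χ‖ ^ 2) * Real.sqrt (c * A * ‖ψ‖ ^ 2) := by gcongr
      _ = c * Real.sqrt (A * B) * ‖ψ‖ * ‖χ‖ := by
          rw [← Real.sqrt_mul (by positivity),
            show c * B * ‖χ‖ ^ 2 * (c * A * ‖ψ‖ ^ 2) = (c * ‖ψ‖ * ‖χ‖) ^ 2 * (A * B) by ring,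
            Real.sqrt_mul (by positivity), Real.sqrt_sq (by positivity)]
          ring
  have hinner : ‖inner ℂ (R χ) (L ψ)‖ ≤ c * Real.sqrt (A * B) * ‖ψ‖ * ‖χ‖ := by
    have hs := lp.hasSum_inner (𝕜 := ℂ) (R χ) (L ψ)
    exact le_of_tendsto hs.norm (Filter.Eventually.of_forall fun F =>
      (norm_sum_le _ _).trans (hsum F))
  have hsq : ‖χ‖ * ‖χ‖ ≤ c * Real.sqrt (A * B) * ‖ψ‖ * ‖χ‖ := by
    rw [← ContinuousLinearMap.adjoint_inner_right, ← hχ, inner_self_eq_norm_sq_to_K] at hinner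
    simpa [sq] using hinner
  rcases (norm_nonneg χ).eq_or_lt with h0 | h0
  · rw [← h0]
    positivity
  · exact le_of_mul_le_mul_right hsq h0

end IsBranching

/-! ### Reduction to cross terms in an abstract Hilbert space -/

section Abstract

variable {E : Type*} [NormedAddCommGroup E] [InnerProductSpace ℂ E]

theorem norm_apply_le_of_norm_le_one {T : E →L[ℂ] E} (hT : ‖T‖ ≤ 1) (x : E) : ‖T x‖ ≤ ‖x‖ := by
  simpa using T.le_of_opNorm_le hT x

variable [CompleteSpace E]

local notation "dag" => ContinuousLinearMap.adjoint

/-- `L` and `R` and their adjoints map `G` into itself. -/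
structure PreservesPair (G : Submodule ℂ E) (L R : E →L[ℂ] E) : Prop where
  left : ∀ φ ∈ G, L φ ∈ G
  right : ∀ φ ∈ G, R φ ∈ G
  left_adj : ∀ φ ∈ G, dag L φ ∈ G
  right_adj : ∀ φ ∈ G, dag R φ ∈ G

/-- `L` and `R` are contractions, isometric on `G`, whose adjoints and range projections map `G`
into itself. -/
structure IsometricPair (G : Submodule ℂ E) (L R : E →L[ℂ] E) : Prop where
  norm_left : ‖L‖ ≤ 1
  norm_right : ‖R‖ ≤ 1
  left_iso : ∀ φ ∈ G, dag L (L φ) = φ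
  right_iso : ∀ φ ∈ G, dag R (R φ) = φ
  left_adj : ∀ φ ∈ G, dag L φ ∈ G
  right_adj : ∀ φ ∈ G, dag R φ ∈ G
  left_proj : ∀ φ ∈ G, L (dag L φ) ∈ G
  right_proj : ∀ φ ∈ G, R (dag R φ) ∈ G

theorem norm_adjoint_apply_le_of_norm_le_one {T : E →L[ℂ] E} (hT : ‖T‖ ≤ 1) (x : E) :
    ‖dag T x‖ ≤ ‖x‖ :=
  norm_apply_le_of_norm_le_one (by rwa [LinearIsometryEquiv.norm_map]) x

theorem norm_sub_range_proj_le {T : E →L[ℂ] E} (hT : ‖T‖ ≤ 1) (x : E) :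
    ‖x - T (dag T x)‖ ≤ 2 * ‖x‖ := by
  have h1 := norm_sub_le x (T (dag T x))
  have h2 := norm_apply_le_of_norm_le_one hT (dag T x)
  have h3 := norm_adjoint_apply_le_of_norm_le_one hT x
  linarith

theorem prV_apply (L R : E →L[ℂ] E) (x : E) :
    prV L R x = L (x - R (dag R x)) + (dag R x - L (dag L (dag R x))) := rfl

theorem norm_prV_apply_le {L R : E →L[ℂ] E} (hL : ‖L‖ ≤ 1) (hR : ‖R‖ ≤ 1) (x : E) :
    ‖prV L R x‖ ≤ 4 * ‖x‖ := by
  rw [prV_apply]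
  have h1 := norm_add_le (L (x - R (dag R x))) (dag R x - L (dag L (dag R x)))
  have h2 := norm_apply_le_of_norm_le_one hL (x - R (dag R x))
  have h3 := norm_sub_range_proj_le hR x
  have h4 := norm_sub_range_proj_le hL (dag R x)
  have h5 := norm_adjoint_apply_le_of_norm_le_one hR x
  linarith

/-- If `R₂† L₁` is small on `G`, then so is `L₁† R₂ R₂†`. -/
theorem norm_adjoint_range_proj_le {G : Submodule ℂ E} {L₁ R₂ : E →L[ℂ] E} {ε : ℝ} (hε : 0 ≤ ε)
    (hR₂ : ‖R₂‖ ≤ 1) (hsmall : ∀ φ ∈ G, ‖dag R₂ (L₁ φ)‖ ≤ ε * ‖φ‖) {r : E}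
    (hr : dag L₁ (R₂ (dag R₂ r)) ∈ G) :
    ‖dag L₁ (R₂ (dag R₂ r))‖ ≤ ε * ‖r‖ := by
  set z := dag L₁ (R₂ (dag R₂ r)) with hz
  have h1 : ‖inner ℂ (dag R₂ (L₁ z)) (dag R₂ r)‖ = ‖z‖ * ‖z‖ := by
    rw [ContinuousLinearMap.adjoint_inner_left, ← ContinuousLinearMap.adjoint_inner_right, ← hz,
      inner_self_eq_norm_sq_to_K]
    simp [sq]
  have h2 : ‖z‖ * ‖z‖ ≤ ε * ‖r‖ * ‖z‖ := by
    rw [← h1]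
    calc ‖inner ℂ (dag R₂ (L₁ z)) (dag R₂ r)‖ ≤ ‖dag R₂ (L₁ z)‖ * ‖dag R₂ r‖ :=
          norm_inner_le_norm _ _
      _ ≤ (ε * ‖z‖) * ‖r‖ := mul_le_mul (hsmall z hr)
          (norm_adjoint_apply_le_of_norm_le_one hR₂ r) (norm_nonneg _) (by positivity)
      _ = ε * ‖r‖ * ‖z‖ := by ring
  rcases (norm_nonneg z).eq_or_lt with h0 | h0
  · rw [← h0]
    positivity
  · exact le_of_mul_le_mul_right h2 h0

/-- If `R₂† L₁` is small on `G`, then applying `prV L₂ R₂` after the two branches of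
`prV L₁ R₁` produces only three branches, up to a small error. -/
theorem norm_prV_branches_sub_le {G : Submodule ℂ E} {L₁ L₂ R₂ : E →L[ℂ] E} {ε : ℝ}
    (hε : 0 ≤ ε) (hL₁ : ‖L₁‖ ≤ 1) (hL₂ : ‖L₂‖ ≤ 1) (hR₂ : ‖R₂‖ ≤ 1)
    (hadj : ∀ φ ∈ G, dag L₁ φ ∈ G) (hproj : ∀ φ ∈ G, R₂ (dag R₂ φ) ∈ G)
    (hsmall : ∀ φ ∈ G, ‖dag R₂ (L₁ φ)‖ ≤ ε * ‖φ‖) {u r : E} (hu : u ∈ G) (hr : r ∈ G) :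
    ‖prV L₂ R₂ (L₁ u + (r - L₁ (dag L₁ r))) -
      (L₂ (L₁ u + ((r - R₂ (dag R₂ r)) - L₁ (dag L₁ (r - R₂ (dag R₂ r))))) +
        (dag R₂ r - L₂ (dag L₂ (dag R₂ r))))‖ ≤ 4 * ε * (‖u‖ + ‖r‖) := by
  set v := dag R₂ (L₁ u) with hv
  set w := dag R₂ (L₁ (dag L₁ r)) with hw
  set z := dag L₁ (R₂ (dag R₂ r)) with hz
  have hvn : ‖v‖ ≤ ε * ‖u‖ := hsmall u hu
  have hwn : ‖w‖ ≤ ε * ‖r‖ := (hsmall _ (hadj r hr)).trans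
    (mul_le_mul_of_nonneg_left (norm_adjoint_apply_le_of_norm_le_one hL₁ r) hε)
  have hzn : ‖z‖ ≤ ε * ‖r‖ :=
    norm_adjoint_range_proj_le hε hR₂ hsmall (hadj _ (hproj r hr))
  have key : prV L₂ R₂ (L₁ u + (r - L₁ (dag L₁ r))) -
      (L₂ (L₁ u + ((r - R₂ (dag R₂ r)) - L₁ (dag L₁ (r - R₂ (dag R₂ r))))) +
        (dag R₂ r - L₂ (dag L₂ (dag R₂ r))))
      = L₂ (R₂ (w - v) - L₁ z) + ((v - w) - L₂ (dag L₂ (v - w))) := by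
    rw [prV_apply]
    simp only [map_add, map_sub, ← hv, ← hw, ← hz]
    abel
  rw [key]
  have b1 : ‖v - w‖ ≤ ε * ‖u‖ + ε * ‖r‖ := (norm_sub_le _ _).trans (add_le_add hvn hwn)
  have b2 := norm_sub_range_proj_le hL₂ (v - w)
  have b3 := norm_apply_le_of_norm_le_one hL₂ (R₂ (w - v) - L₁ z)
  have b4 := norm_sub_le (R₂ (w - v)) (L₁ z)
  have b5 := norm_apply_le_of_norm_le_one hR₂ (w - v)
  have b6 := norm_apply_le_of_norm_le_one hL₁ z
  have b7 := norm_sub_rev v w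
  have b8 := norm_add_le (L₂ (R₂ (w - v) - L₁ z)) ((v - w) - L₂ (dag L₂ (v - w)))
  have b9 : 0 ≤ ε * ‖u‖ := by positivity
  linarith

/-- The four branches of the glued operator on vectors of low degree. -/
theorem gluedOp_apply_eq {G₁ G₂ G₃ : Submodule ℂ E} {L₁ R₁ L₂ R₂ L₃ R₃ : E →L[ℂ] E}
    (h₁ : IsometricPair G₁ L₁ R₁) (h₂ : IsometricPair G₂ L₂ R₂) (h₃ : IsometricPair G₃ L₃ R₃)
    (h₁₂ : PreservesPair G₁ L₂ R₂) (h₁₃ : PreservesPair G₁ L₃ R₃)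
    (h₂₁ : PreservesPair G₂ L₁ R₁) (h₂₃ : PreservesPair G₂ L₃ R₃)
    (h₃₁ : PreservesPair G₃ L₁ R₁) (h₃₂ : PreservesPair G₃ L₂ R₂)
    {φ : E} (hφ₁ : φ ∈ G₁) (hφ₂ : φ ∈ G₂) (hφ₃ : φ ∈ G₃) {u r q : E}
    (hu : u = φ - R₁ (dag R₁ φ)) (hr : r = dag R₁ φ) (hq : q = dag R₂ r) :
    gluedOp L₁ R₁ L₂ R₂ L₃ R₃ φ =
      L₃ (L₂ (L₁ u + ((r - R₂ (dag R₂ r)) - L₁ (dag L₁ (r - R₂ (dag R₂ r))))) +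
        ((q - R₃ (dag R₃ q)) - L₂ (dag L₂ (q - R₃ (dag R₃ q))))) +
      (dag R₃ q - L₃ (dag L₃ (dag R₃ q))) := by
  have hr₁ : r ∈ G₁ := hr ▸ h₁.right_adj _ hφ₁
  have hr₂ : r ∈ G₂ := hr ▸ h₂₁.right_adj _ hφ₂
  have hr₃ : r ∈ G₃ := hr ▸ h₃₁.right_adj _ hφ₃
  have hu₁ : u ∈ G₁ := hu ▸ G₁.sub_mem hφ₁ (h₁.right_proj _ hφ₁)
  have hu₂ : u ∈ G₂ := hu ▸ G₂.sub_mem hφ₂ (h₂₁.right _ (h₂₁.right_adj _ hφ₂))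
  have hu₃ : u ∈ G₃ := hu ▸ G₃.sub_mem hφ₃ (h₃₁.right _ (h₃₁.right_adj _ hφ₃))
  have hq₁ : q ∈ G₁ := hq ▸ h₁₂.right_adj _ hr₁
  have hq₂ : q ∈ G₂ := hq ▸ h₂.right_adj _ hr₂
  have hq₃ : q ∈ G₃ := hq ▸ h₃₂.right_adj _ hr₃
  have hPr₁ : R₂ (dag R₂ r) ∈ G₁ := h₁₂.right _ (h₁₂.right_adj _ hr₁)
  have hPr₂ : R₂ (dag R₂ r) ∈ G₂ := h₂.right_proj _ hr₂
  have hPr₃ : R₂ (dag R₂ r) ∈ G₃ := h₃₂.right _ (h₃₂.right_adj _ hr₃)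
  obtain ⟨w, hw⟩ : ∃ w, w = r - R₂ (dag R₂ r) := ⟨_, rfl⟩
  obtain ⟨y, hy⟩ : ∃ y, y = q - R₃ (dag R₃ q) := ⟨_, rfl⟩
  have hw₂ : w ∈ G₂ := hw ▸ G₂.sub_mem hr₂ hPr₂
  have hw₃ : w ∈ G₃ := hw ▸ G₃.sub_mem hr₃ hPr₃
  have hy₃ : y ∈ G₃ := hy ▸ G₃.sub_mem hq₃ (h₃.right_proj _ hq₃)
  have hPq₂ : R₃ (dag R₃ q) ∈ G₂ := h₂₃.right _ (h₂₃.right_adj _ hq₂)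
  have hPq₁ : R₂ (R₃ (dag R₃ q)) ∈ G₁ :=
    h₁₂.right _ (h₁₃.right _ (h₁₃.right_adj _ hq₁))
  have expand : gluedOp L₁ R₁ L₂ R₂ L₃ R₃ φ =
      L₃ (L₂ (L₁ (dag L₁ (dag L₂ (dag L₃ (L₃ (L₂ (L₁ u)))))))) +
      (L₃ (L₂ (dag L₂ (dag L₃ (L₃ (L₂ (dag R₁ (R₁ r - R₁ (R₂ q)))))))) -
        L₃ (L₂ (L₁ (dag L₁ (dag L₂ (dag L₃ (L₃ (L₂ (dag R₁ (R₁ r - R₁ (R₂ q))))))))))) +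
      (L₃ (dag L₃ (L₃ (dag R₂ (dag R₁ (R₁ (R₂ q) - R₁ (R₂ (R₃ (dag R₃ q)))))))) -
        L₃ (L₂ (dag L₂ (dag L₃ (L₃ (dag R₂ (dag R₁
          (R₁ (R₂ q) - R₁ (R₂ (R₃ (dag R₃ q))))))))))) +
      (dag R₃ (dag R₂ (dag R₁ (R₁ (R₂ (R₃ (dag R₃ q)))))) -
        L₃ (dag L₃ (dag R₃ (dag R₂ (dag R₁ (R₁ (R₂ (R₃ (dag R₃ q))))))))) := by
    subst hq hr hu
    rfl
  have hw' : dag R₁ (R₁ r - R₁ (R₂ q)) = w := by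
    rw [map_sub, h₁.right_iso _ hr₁, hq, h₁.right_iso _ hPr₁, hw]
  have hPq' : dag R₂ (dag R₁ (R₁ (R₂ (R₃ (dag R₃ q))))) = R₃ (dag R₃ q) := by
    rw [h₁.right_iso _ hPq₁, h₂.right_iso _ hPq₂]
  have hy' : dag R₂ (dag R₁ (R₁ (R₂ q) - R₁ (R₂ (R₃ (dag R₃ q))))) = y := by
    rw [map_sub, map_sub, hPq', h₁.right_iso _ (hq ▸ hPr₁), h₂.right_iso _ hq₂, hy]
  rw [expand, hw', hy', hPq', h₃.left_iso _ (h₃₂.left _ (h₃₁.left _ hu₃)),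
    h₂.left_iso _ (h₂₁.left _ hu₂), h₁.left_iso _ hu₁, h₃.left_iso _ (h₃₂.left _ hw₃),
    h₂.left_iso _ hw₂, h₃.left_iso _ hy₃, h₃.right_iso _ (h₃.right_adj _ hq₃), ← hw, ← hy]
  simp only [map_add, map_sub]

/-- The glued operator is close to the composition on vectors of low degree as soon as the cross
terms `R₂† L₁` and `R₃† L₂` are small there. -/
theorem norm_gluedOp_sub_comp_apply_le {G₁ G₂ G₃ : Submodule ℂ E}
    {L₁ R₁ L₂ R₂ L₃ R₃ : E →L[ℂ] E} {ε : ℝ} (hε : 0 ≤ ε)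
    (h₁ : IsometricPair G₁ L₁ R₁) (h₂ : IsometricPair G₂ L₂ R₂) (h₃ : IsometricPair G₃ L₃ R₃)
    (h₁₂ : PreservesPair G₁ L₂ R₂) (h₁₃ : PreservesPair G₁ L₃ R₃)
    (h₂₁ : PreservesPair G₂ L₁ R₁) (h₂₃ : PreservesPair G₂ L₃ R₃)
    (h₃₁ : PreservesPair G₃ L₁ R₁) (h₃₂ : PreservesPair G₃ L₂ R₂)
    (hsmall₁₂ : ∀ φ ∈ G₁ ⊓ G₂, ‖dag R₂ (L₁ φ)‖ ≤ ε * ‖φ‖)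
    (hsmall₂₃ : ∀ φ ∈ G₂ ⊓ G₃, ‖dag R₃ (L₂ φ)‖ ≤ ε * ‖φ‖)
    {φ : E} (hφ₁ : φ ∈ G₁) (hφ₂ : φ ∈ G₂) (hφ₃ : φ ∈ G₃) :
    ‖(gluedOp L₁ R₁ L₂ R₂ L₃ R₃ - prV L₃ R₃ * prV L₂ R₂ * prV L₁ R₁) φ‖
      ≤ 76 * ε * ‖φ‖ := by
  obtain ⟨u, hu⟩ : ∃ u, u = φ - R₁ (dag R₁ φ) := ⟨_, rfl⟩
  obtain ⟨r, hr⟩ : ∃ r, r = dag R₁ φ := ⟨_, rfl⟩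
  obtain ⟨q, hq⟩ : ∃ q, q = dag R₂ r := ⟨_, rfl⟩
  have hglued := gluedOp_apply_eq h₁ h₂ h₃ h₁₂ h₁₃ h₂₁ h₂₃ h₃₁ h₃₂ hφ₁ hφ₂ hφ₃ hu hr hq
  obtain ⟨s, hs⟩ : ∃ s, s = r - R₂ (dag R₂ r) := ⟨_, rfl⟩
  obtain ⟨x, hx⟩ : ∃ x, x = L₁ u + (s - L₁ (dag L₁ s)) := ⟨_, rfl⟩
  have hr₁ : r ∈ G₁ := hr ▸ h₁.right_adj _ hφ₁
  have hr₂ : r ∈ G₂ := hr ▸ h₂₁.right_adj _ hφ₂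
  have hr₃ : r ∈ G₃ := hr ▸ h₃₁.right_adj _ hφ₃
  have hu₁ : u ∈ G₁ := hu ▸ G₁.sub_mem hφ₁ (h₁.right_proj _ hφ₁)
  have hu₂ : u ∈ G₂ := hu ▸ G₂.sub_mem hφ₂ (h₂₁.right _ (h₂₁.right_adj _ hφ₂))
  have hu₃ : u ∈ G₃ := hu ▸ G₃.sub_mem hφ₃ (h₃₁.right _ (h₃₁.right_adj _ hφ₃))
  have hq₂ : q ∈ G₂ := hq ▸ h₂.right_adj _ hr₂
  have hq₃ : q ∈ G₃ := hq ▸ h₃₂.right_adj _ hr₃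
  have hs₂ : s ∈ G₂ := hs ▸ G₂.sub_mem hr₂ (h₂.right_proj _ hr₂)
  have hs₃ : s ∈ G₃ := hs ▸ G₃.sub_mem hr₃ (h₃₂.right _ (h₃₂.right_adj _ hr₃))
  have hx₂ : x ∈ G₂ := hx ▸ G₂.add_mem (h₂₁.left _ hu₂)
    (G₂.sub_mem hs₂ (h₂₁.left _ (h₂₁.left_adj _ hs₂)))
  have hx₃ : x ∈ G₃ := hx ▸ G₃.add_mem (h₃₁.left _ hu₃)
    (G₃.sub_mem hs₃ (h₃₁.left _ (h₃₁.left_adj _ hs₃)))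
  have hfst := norm_prV_branches_sub_le (G := G₁ ⊓ G₂) (L₂ := L₂) (R₂ := R₂) hε
    h₁.norm_left h₂.norm_left h₂.norm_right
    (fun φ hφ => ⟨h₁.left_adj φ hφ.1, h₂₁.left_adj φ hφ.2⟩)
    (fun φ hφ => ⟨h₁₂.right _ (h₁₂.right_adj φ hφ.1), h₂.right_proj φ hφ.2⟩)
    hsmall₁₂ (u := u) (r := r) ⟨hu₁, hu₂⟩ ⟨hr₁, hr₂⟩
  have hsnd := norm_prV_branches_sub_le (G := G₂ ⊓ G₃) (L₂ := L₃) (R₂ := R₃) hε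
    h₂.norm_left h₃.norm_left h₃.norm_right
    (fun φ hφ => ⟨h₂.left_adj φ hφ.1, h₃₂.left_adj φ hφ.2⟩)
    (fun φ hφ => ⟨h₂₃.right _ (h₂₃.right_adj φ hφ.1), h₃.right_proj φ hφ.2⟩)
    hsmall₂₃ (u := x) (r := q) ⟨hx₂, hx₃⟩ ⟨hq₂, hq₃⟩
  rw [← hs, ← hx, ← hq] at hfst
  rw [← hs, ← hx] at hglued
  rw [← hglued] at hsnd
  have hcomp : prV L₁ R₁ φ = L₁ u + (r - L₁ (dag L₁ r)) := by rw [prV_apply, ← hr, hu, hr]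
  rw [← hcomp] at hfst
  have hsplit : (gluedOp L₁ R₁ L₂ R₂ L₃ R₃ - prV L₃ R₃ * prV L₂ R₂ * prV L₁ R₁) φ =
      -(prV L₃ R₃ (prV L₂ R₂ (prV L₁ R₁ φ) - (L₂ x + (q - L₂ (dag L₂ q))))) -
      (prV L₃ R₃ (L₂ x + (q - L₂ (dag L₂ q))) - gluedOp L₁ R₁ L₂ R₂ L₃ R₃ φ) := by
    rw [map_sub]
    change gluedOp L₁ R₁ L₂ R₂ L₃ R₃ φ - prV L₃ R₃ (prV L₂ R₂ (prV L₁ R₁ φ)) = _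
    abel
  have hun : ‖u‖ ≤ 2 * ‖φ‖ := hu ▸ norm_sub_range_proj_le h₁.norm_right φ
  have hrn : ‖r‖ ≤ ‖φ‖ := hr ▸ norm_adjoint_apply_le_of_norm_le_one h₁.norm_right φ
  have hqn : ‖q‖ ≤ ‖r‖ := hq ▸ norm_adjoint_apply_le_of_norm_le_one h₂.norm_right r
  have hsn : ‖s‖ ≤ 2 * ‖r‖ := hs ▸ norm_sub_range_proj_le h₂.norm_right r
  have hxn : ‖x‖ ≤ ‖u‖ + 2 * ‖s‖ := hx ▸ (norm_add_le _ _).trans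
    (add_le_add (norm_apply_le_of_norm_le_one h₁.norm_left u)
      (norm_sub_range_proj_le h₁.norm_left s))
  rw [hsplit]
  refine (norm_sub_le _ _).trans ?_
  rw [norm_neg]
  have hV := norm_prV_apply_le h₃.norm_left h₃.norm_right
    (prV L₂ R₂ (prV L₁ R₁ φ) - (L₂ x + (q - L₂ (dag L₂ q))))
  have e₁ : ε * (‖u‖ + ‖r‖) ≤ ε * (3 * ‖φ‖) := mul_le_mul_of_nonneg_left (by linarith) hε
  have e₂ : ε * (‖x‖ + ‖q‖) ≤ ε * (7 * ‖φ‖) := mul_le_mul_of_nonneg_left (by linarith) hε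
  linarith

theorem norm_mul_le_one {S T : E →L[ℂ] E} (hS : ‖S‖ ≤ 1) (hT : ‖T‖ ≤ 1) : ‖S * T‖ ≤ 1 :=
  (norm_mul_le S T).trans (mul_le_one₀ hS (norm_nonneg _) hT)

theorem norm_sub_mul_mul_sub_le {A B S C D : E →L[ℂ] E} (hA : ‖A‖ ≤ 1) (hB : ‖B‖ ≤ 1)
    (hS : ‖S‖ ≤ 1) (hC : ‖C‖ ≤ 1) (hD : ‖D‖ ≤ 1) : ‖(A - B) * S * (C - D)‖ ≤ 4 := by
  have hAB : ‖A - B‖ ≤ 2 := (norm_sub_le _ _).trans (by linarith)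
  have hCD : ‖C - D‖ ≤ 2 := (norm_sub_le _ _).trans (by linarith)
  calc ‖(A - B) * S * (C - D)‖ ≤ ‖A - B‖ * ‖S‖ * ‖C - D‖ := norm_mul₃_le
    _ ≤ 2 * 1 * 2 := by gcongr
    _ = 4 := by norm_num

theorem norm_gluedOp_le {L₁ R₁ L₂ R₂ L₃ R₃ : E →L[ℂ] E} (hL₁ : ‖L₁‖ ≤ 1) (hR₁ : ‖R₁‖ ≤ 1)
    (hL₂ : ‖L₂‖ ≤ 1) (hR₂ : ‖R₂‖ ≤ 1) (hL₃ : ‖L₃‖ ≤ 1) (hR₃ : ‖R₃‖ ≤ 1) :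
    ‖gluedOp L₁ R₁ L₂ R₂ L₃ R₃‖ ≤ 16 := by
  have hadj : ∀ {T : E →L[ℂ] E}, ‖T‖ ≤ 1 → ‖dag T‖ ≤ 1 := fun hT => by
    rwa [LinearIsometryEquiv.norm_map]
  have h0 : ‖(0 : E →L[ℂ] E)‖ ≤ 1 := by simp
  have h1 : ‖(1 : E →L[ℂ] E)‖ ≤ 1 := ContinuousLinearMap.norm_id_le
  have hPR1 : ‖R₁ * dag R₁‖ ≤ 1 := norm_mul_le_one hR₁ (hadj hR₁)
  have hPR12 : ‖R₁ * R₂ * dag R₂ * dag R₁‖ ≤ 1 := norm_mul_le_one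
    (norm_mul_le_one (norm_mul_le_one hR₁ hR₂) (hadj hR₂)) (hadj hR₁)
  have hPR123 : ‖R₁ * R₂ * R₃ * dag R₃ * dag R₂ * dag R₁‖ ≤ 1 := norm_mul_le_one
    (norm_mul_le_one (norm_mul_le_one (norm_mul_le_one (norm_mul_le_one hR₁ hR₂) hR₃) (hadj hR₃))
      (hadj hR₂)) (hadj hR₁)
  have hPL3 : ‖L₃ * dag L₃‖ ≤ 1 := norm_mul_le_one hL₃ (hadj hL₃)
  have hPL32 : ‖L₃ * L₂ * dag L₂ * dag L₃‖ ≤ 1 := norm_mul_le_one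
    (norm_mul_le_one (norm_mul_le_one hL₃ hL₂) (hadj hL₂)) (hadj hL₃)
  have hPL321 : ‖L₃ * L₂ * L₁ * dag L₁ * dag L₂ * dag L₃‖ ≤ 1 := norm_mul_le_one
    (norm_mul_le_one (norm_mul_le_one (norm_mul_le_one (norm_mul_le_one hL₃ hL₂) hL₁) (hadj hL₁))
      (hadj hL₂)) (hadj hL₃)
  have t1 := norm_sub_mul_mul_sub_le hPL321 h0
    (norm_mul_le_one (norm_mul_le_one hL₃ hL₂) hL₁) h1 hPR1
  have t2 := norm_sub_mul_mul_sub_le hPL32 hPL321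
    (norm_mul_le_one (norm_mul_le_one hL₃ hL₂) (hadj hR₁)) hPR1 hPR12
  have t3 := norm_sub_mul_mul_sub_le hPL3 hPL32
    (norm_mul_le_one (norm_mul_le_one hL₃ (hadj hR₂)) (hadj hR₁)) hPR12 hPR123
  have t4 := norm_sub_mul_mul_sub_le h1 hPL3
    (norm_mul_le_one (norm_mul_le_one (hadj hR₃) (hadj hR₂)) (hadj hR₁)) hPR123 h0
  rw [sub_zero] at t1 t4
  refine (norm_add_le_of_le (norm_add_le_of_le (norm_add_le_of_le t1 t2) t3) t4).trans ?_
  norm_num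

/-- A crude bound that needs no assumption on the cross terms. -/
theorem norm_gluedOp_sub_comp_le {L₁ R₁ L₂ R₂ L₃ R₃ : E →L[ℂ] E} (hL₁ : ‖L₁‖ ≤ 1)
    (hR₁ : ‖R₁‖ ≤ 1) (hL₂ : ‖L₂‖ ≤ 1) (hR₂ : ‖R₂‖ ≤ 1) (hL₃ : ‖L₃‖ ≤ 1) (hR₃ : ‖R₃‖ ≤ 1) :
    ‖gluedOp L₁ R₁ L₂ R₂ L₃ R₃ - prV L₃ R₃ * prV L₂ R₂ * prV L₁ R₁‖ ≤ 80 := by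
  have hV : ∀ {L R : E →L[ℂ] E}, ‖L‖ ≤ 1 → ‖R‖ ≤ 1 → ‖prV L R‖ ≤ 4 := fun hL hR =>
    ContinuousLinearMap.opNorm_le_bound _ (by norm_num) (norm_prV_apply_le hL hR)
  have hcomp : ‖prV L₃ R₃ * prV L₂ R₂ * prV L₁ R₁‖ ≤ 64 :=
    calc ‖prV L₃ R₃ * prV L₂ R₂ * prV L₁ R₁‖
        ≤ ‖prV L₃ R₃‖ * ‖prV L₂ R₂‖ * ‖prV L₁ R₁‖ := norm_mul₃_le
      _ ≤ 4 * 4 * 4 := by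
          have h₁ := hV hL₁ hR₁
          have h₂ := hV hL₂ hR₂
          have h₃ := hV hL₃ hR₃
          gcongr
      _ = 64 := by norm_num
  refine (norm_sub_le_of_le (norm_gluedOp_le hL₁ hR₁ hL₂ hR₂ hL₃ hR₃) hcomp).trans ?_
  norm_num

end Abstract

/-! ### Path-recording operators are branching -/

section PathRecording

variable {ι σ ρ σ' ρ' : Type}

/-- The set of outputs excluded by the two databases of a system. -/
def blocked [DecidableEq σ] (e : ι ≃ σ × Multiset (σ × σ) × Multiset (σ × σ) × ρ) (i : ι) :
    Finset σ :=
  dbIm ((e i).2.1 + dbInv (e i).2.2.1)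

/-- The basis state obtained by recording the output `y` in the first database. -/
def child (e : ι ≃ σ × Multiset (σ × σ) × Multiset (σ × σ) × ρ) (i : ι) (y : σ) : ι :=
  e.symm (y, ((e i).1, y) ::ₘ (e i).2.1, (e i).2.2.1, (e i).2.2.2)

open Classical in
/-- The basis states reached from `i` by one query. -/
def children [Fintype σ] [DecidableEq σ]
    (e : ι ≃ σ × Multiset (σ × σ) × Multiset (σ × σ) × ρ) (i : ι) : Finset ι :=
  (blocked e i)ᶜ.image (child e i)

/-- The amplitude of a single child. -/
def weight [Fintype σ] [DecidableEq σ]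
    (e : ι ≃ σ × Multiset (σ × σ) × Multiset (σ × σ) × ρ) (i : ι) : ℝ :=
  (Real.sqrt ((Fintype.card σ : ℝ) - (blocked e i).card))⁻¹

/-- The total size of the two databases of a system. -/
def dbSize (e : ι ≃ σ × Multiset (σ × σ) × Multiset (σ × σ) × ρ) (i : ι) : ℕ :=
  Multiset.card (e i).2.1 + Multiset.card (e i).2.2.1

/-- `V` is the path-recording operator of the system described by `e`, which splits a basis state
into the query register, the database written to, the other database and the rest. -/
def IsPathRecording [Fintype σ] [DecidableEq σ]
    (e : ι ≃ σ × Multiset (σ × σ) × Multiset (σ × σ) × ρ)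
    (V : QState ι →L[ℂ] QState ι) : Prop :=
  ∀ i, V (ket i) = (weight e i : ℂ) • ∑ y ∈ (blocked e i)ᶜ, ket (child e i y)

/-- Exchange of the two databases of a system. -/
def swapDB (D ρ : Type) : σ × D × D × ρ ≃ σ × D × D × ρ where
  toFun x := (x.1, x.2.2.1, x.2.1, x.2.2.2)
  invFun x := (x.1, x.2.2.1, x.2.1, x.2.2.2)
  left_inv _ := rfl
  right_inv _ := rfl

theorem dbSize_swap (e : ι ≃ σ × Multiset (σ × σ) × Multiset (σ × σ) × ρ) (i : ι) :
    dbSize (e.trans (swapDB _ ρ)) i = dbSize e i :=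
  add_comm _ _

/-- The databases of the system `e'` belong to the registers not touched by the system `e`. -/
def IndependentDB (e : ι ≃ σ × Multiset (σ × σ) × Multiset (σ × σ) × ρ)
    (e' : ι ≃ σ' × Multiset (σ' × σ') × Multiset (σ' × σ') × ρ') : Prop :=
  ∀ m i, (e m).2.2.2 = (e i).2.2.2 →
    (e' m).2.1 = (e' i).2.1 ∧ (e' m).2.2.1 = (e' i).2.2.1

variable {e : ι ≃ σ × Multiset (σ × σ) × Multiset (σ × σ) × ρ}
  {e' : ι ≃ σ' × Multiset (σ' × σ') × Multiset (σ' × σ') × ρ'}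

theorem IndependentDB.swap_left (h : IndependentDB e e') :
    IndependentDB (e.trans (swapDB _ ρ)) e' := h

theorem IndependentDB.swap_right (h : IndependentDB e e') :
    IndependentDB e (e'.trans (swapDB _ ρ')) := fun m i hmi => (h m i hmi).symm

theorem child_injective (i : ι) : Function.Injective (child e i) := fun y y' h => by
  simpa [child] using congrArg (fun m => (e m).1) h

variable [DecidableEq σ]

theorem blocked_card_le (i : ι) : (blocked e i).card ≤ dbSize e i := by
  refine (Multiset.toFinset_card_le _).trans ?_
  simp [dbSize, dbInv]

variable [Fintype σ]

theorem card_children (i : ι) :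
    ((children e i).card : ℝ) = (Fintype.card σ : ℝ) - (blocked e i).card := by
  classical
  rw [children, Finset.card_image_of_injective _ (child_injective i), Finset.card_compl,
    Nat.cast_sub (Finset.card_le_univ _)]

theorem mem_children {i m : ι} :
    m ∈ children e i ↔ (e m).1 ∉ blocked e i ∧ (e m).2.1 = ((e i).1, (e m).1) ::ₘ (e i).2.1 ∧
      (e m).2.2.1 = (e i).2.2.1 ∧ (e m).2.2.2 = (e i).2.2.2 := by
  simp only [children, Finset.mem_image, Finset.mem_compl]
  constructor
  · rintro ⟨y, hy, rfl⟩
    simp [child, hy]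
  · rintro ⟨h1, h2, h3, h4⟩
    refine ⟨(e m).1, h1, ?_⟩
    rw [child, ← h2, ← h3, ← h4]
    exact e.symm_apply_apply m

theorem dbSize_of_mem_children {i m : ι} (h : m ∈ children e i) :
    dbSize e m = dbSize e i + 1 := by
  obtain ⟨-, h2, h3, -⟩ := mem_children.1 h
  rw [dbSize, dbSize, h2, h3, Multiset.card_cons]
  ring

theorem mem_dbIm_of_mem_children {i m : ι} (h : m ∈ children e i) :
    (e m).1 ∈ dbIm (e m).2.1 := by
  obtain ⟨-, h2, -, -⟩ := mem_children.1 h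
  rw [h2]
  simp [dbIm]

theorem parent_unique_of_mem_children {i j m : ι} (hi : m ∈ children e i)
    (hj : m ∈ children e j) : i = j := by
  obtain ⟨hi1, hi2, hi3, hi4⟩ := mem_children.1 hi
  obtain ⟨hj1, hj2, hj3, hj4⟩ := mem_children.1 hj
  have hcons := hi2.symm.trans hj2
  have hmem : ((e i).1, (e m).1) ∈ ((e j).1, (e m).1) ::ₘ (e j).2.1 :=
    hcons ▸ Multiset.mem_cons_self _ _
  have hx : (e i).1 = (e j).1 := by
    rcases Multiset.mem_cons.1 hmem with h | h
    · exact (Prod.mk.inj h).1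
    · refine absurd ?_ hj1
      simp only [blocked, dbIm, Multiset.map_add, Multiset.mem_toFinset, Multiset.mem_add]
      exact Or.inl (Multiset.mem_map.2 ⟨_, h, rfl⟩)
  have hL : (e i).2.1 = (e j).2.1 := by
    rw [hx] at hcons
    exact (Multiset.cons_inj_right _).1 hcons
  apply e.injective
  exact Prod.ext hx (Prod.ext hL (Prod.ext (hi3.symm.trans hj3) (hi4.symm.trans hj4)))

theorem weight_sq (i : ι) : weight e i ^ 2 = ((children e i).card : ℝ)⁻¹ := by
  rw [card_children, weight, inv_pow, Real.sq_sqrt]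
  rw [← card_children]
  positivity

theorem weight_sq_mul_card {i : ι} (h : dbSize e i < Fintype.card σ) :
    weight e i ^ 2 * (children e i).card = 1 := by
  rw [weight_sq, inv_mul_cancel₀]
  rw [card_children, sub_ne_zero]
  exact_mod_cast ((blocked_card_le i).trans_lt h).ne'

theorem weight_sq_le {i : ι} (h : 2 * dbSize e i ≤ Fintype.card σ)
    (hσ : 0 < Fintype.card σ) : weight e i ^ 2 ≤ 2 / Fintype.card σ := by
  rw [weight_sq, card_children]
  have h1 : ((blocked e i).card : ℝ) ≤ dbSize e i := by exact_mod_cast blocked_card_le i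
  have h2 : 2 * (dbSize e i : ℝ) ≤ Fintype.card σ := by exact_mod_cast h
  have h3 : (0 : ℝ) < Fintype.card σ := by exact_mod_cast hσ
  rw [← inv_div]
  exact inv_anti₀ (by positivity) (by linarith)

theorem IsPathRecording.isBranching {V : QState ι →L[ℂ] QState ι} (hV : IsPathRecording e V) :
    IsBranching V (weight e) (children e) where
  apply_ket i := by
    classical
    rw [hV i, children, Finset.sum_image fun _ _ _ _ h => child_injective i h]
  parent_unique := parent_unique_of_mem_children
  weight_le i := by
    rw [weight_sq]
    exact inv_mul_le_one

/-- The operator pair of one system is well behaved on states with small databases. -/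
theorem IsPathRecording.isometricPair {L R : QState ι →L[ℂ] QState ι}
    (hL : IsPathRecording e L) (hR : IsPathRecording (e.trans (swapDB _ ρ)) R) {t : ℕ}
    (ht : t < Fintype.card σ) : IsometricPair (supportedOn {i | dbSize e i ≤ t}) L R := by
  have gL : ∀ i, ∀ m ∈ children e i, dbSize e m = dbSize e i + 1 :=
    fun i m hm => dbSize_of_mem_children hm
  have gR : ∀ i, ∀ m ∈ children (e.trans (swapDB _ ρ)) i, dbSize e m = dbSize e i + 1 :=
    fun i m hm => by simpa only [dbSize_swap] using dbSize_of_mem_children hm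
  refine ⟨hL.isBranching.norm_le_one, hR.isBranching.norm_le_one, fun φ hφ => ?_, fun φ hφ => ?_,
    fun φ hφ => ?_, fun φ hφ => ?_, fun φ hφ => ?_, fun φ hφ => ?_⟩
  · exact hL.isBranching.adjoint_apply_self
      (fun i hi => weight_sq_mul_card (lt_of_le_of_lt hi ht)) hφ
  · exact hR.isBranching.adjoint_apply_self
      (fun i hi => weight_sq_mul_card (lt_of_le_of_lt (by rw [dbSize_swap]; exact hi) ht)) hφ
  · exact hL.isBranching.adjoint_apply_mem (fun i m hm h => by
      have := gL i m hm
      simp only [Set.mem_ofPred_eq] at h ⊢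
      omega) hφ
  · exact hR.isBranching.adjoint_apply_mem (fun i m hm h => by
      have := gR i m hm
      simp only [Set.mem_ofPred_eq] at h ⊢
      omega) hφ
  · exact hL.isBranching.apply_adjoint_apply_mem (fun i m hm m' hm' h => by
      have h1 := gL i m hm
      have h2 := gL i m' hm'
      simp only [Set.mem_ofPred_eq] at h ⊢
      omega) hφ
  · exact hR.isBranching.apply_adjoint_apply_mem (fun i m hm m' hm' h => by
      have h1 := gR i m hm
      have h2 := gR i m' hm'
      simp only [Set.mem_ofPred_eq] at h ⊢
      omega) hφ

theorem IndependentDB.dbSize_eq (h : IndependentDB e e') {i m : ι} (hm : m ∈ children e i) :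
    dbSize e' m = dbSize e' i := by
  obtain ⟨h1, h2⟩ := h m i (mem_children.1 hm).2.2.2
  rw [dbSize, dbSize, h1, h2]

/-- The operator pair of one system preserves the database sizes of the other systems. -/
theorem IndependentDB.preservesPair (h : IndependentDB e e') {L R : QState ι →L[ℂ] QState ι}
    (hL : IsPathRecording e L) (hR : IsPathRecording (e.trans (swapDB _ ρ)) R) (t : ℕ) :
    PreservesPair (supportedOn {i | dbSize e' i ≤ t}) L R := by
  have gL : ∀ i, ∀ m ∈ children e i, dbSize e' m = dbSize e' i := fun i m hm => h.dbSize_eq hm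
  have gR : ∀ i, ∀ m ∈ children (e.trans (swapDB _ ρ)) i, dbSize e' m = dbSize e' i :=
    fun i m hm => h.swap_left.dbSize_eq hm
  refine ⟨fun φ hφ => ?_, fun φ hφ => ?_, fun φ hφ => ?_, fun φ hφ => ?_⟩
  · exact hL.isBranching.apply_mem (fun i m hm hi => (gL i m hm).trans_le hi) hφ
  · exact hR.isBranching.apply_mem (fun i m hm hi => (gR i m hm).trans_le hi) hφ
  · exact hL.isBranching.adjoint_apply_mem (fun i m hm hi => (gL i m hm).symm.trans_le hi) hφ
  · exact hR.isBranching.adjoint_apply_mem (fun i m hm hi => (gR i m hm).symm.trans_le hi) hφ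

variable [Fintype σ'] [DecidableEq σ']

open Classical in
/-- Few children of a state for one system are also children for a system that shares the
subregister `β` with it. -/
theorem IndependentDB.card_common_children_le (h : IndependentDB e e') {β γ : Type} [Fintype γ]
    {π : σ → β} {κ : σ → γ} (hinj : Function.Injective fun x => (π x, κ x)) {π' : σ' → β}
    (hπ : ∀ m, π (e m).1 = π' (e' m).1) (i : ι) :
    {m ∈ children e i | ∃ j, m ∈ children e' j}.card ≤ Fintype.card γ * dbSize e' i := by
  calc {m ∈ children e i | ∃ j, m ∈ children e' j}.card
      ≤ (((dbIm (e' i).2.1).image π') ×ˢ (Finset.univ : Finset γ)).card := by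
        refine Finset.card_le_card_of_injOn (fun m => (π (e m).1, κ (e m).1)) ?_ ?_
        · intro m hm
          obtain ⟨hmi, j, hmj⟩ := Finset.mem_filter.1 hm
          have h1 := mem_dbIm_of_mem_children hmj
          rw [(h m i (mem_children.1 hmi).2.2.2).1] at h1
          refine Finset.mem_coe.2 (Finset.mem_product.2 ⟨?_, Finset.mem_univ _⟩)
          exact Finset.mem_image.2 ⟨_, h1, (hπ m).symm⟩
        · intro m hm m' hm' heq
          have hmi := mem_children.1 (Finset.mem_filter.1 hm).1
          have hmi' := mem_children.1 (Finset.mem_filter.1 hm').1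
          have hx : (e m).1 = (e m').1 := hinj heq
          apply e.injective
          refine Prod.ext hx (Prod.ext ?_ (Prod.ext (hmi.2.2.1.trans hmi'.2.2.1.symm)
            (hmi.2.2.2.trans hmi'.2.2.2.symm)))
          rw [hmi.2.1, hmi'.2.1, hx]
    _ ≤ Fintype.card γ * dbSize e' i := by
        rw [Finset.card_product, mul_comm, Finset.card_univ]
        refine Nat.mul_le_mul_left _ (Finset.card_image_le.trans
          ((Multiset.toFinset_card_le _).trans ?_))
        rw [Multiset.card_map]
        exact Nat.le_add_right _ _

/-- Two systems sharing only the subregister `β` have a small cross term. -/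
theorem norm_cross_term_le (h : IndependentDB e e') (h' : IndependentDB e' e)
    {β γ γ' : Type} [Fintype γ] [Fintype γ'] {π : σ → β} {κ : σ → γ}
    (hinj : Function.Injective fun x => (π x, κ x)) {π' : σ' → β} {κ' : σ' → γ'}
    (hinj' : Function.Injective fun x => (π' x, κ' x)) (hπ : ∀ m, π (e m).1 = π' (e' m).1)
    {L R : QState ι →L[ℂ] QState ι} (hL : IsPathRecording e L) (hR : IsPathRecording e' R)
    {n lam t : ℕ} (hγ : Fintype.card γ = 2 ^ n) (hγ' : Fintype.card γ' = 2 ^ n)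
    (hσ : Fintype.card σ = 2 ^ (n + lam)) (hσ' : Fintype.card σ' = 2 ^ (n + lam))
    (ht : 2 * t ≤ 2 ^ lam) {ψ : QState ι}
    (hψ : ψ ∈ supportedOn {i | dbSize e i ≤ t} ⊓ supportedOn {i | dbSize e' i ≤ t}) :
    ‖ContinuousLinearMap.adjoint R (L ψ)‖ ≤ 4 * t / 2 ^ lam * ‖ψ‖ := by
  classical
  have htN : 2 * t ≤ 2 ^ (n + lam) :=
    ht.trans (Nat.pow_le_pow_right two_pos (Nat.le_add_left _ _))
  have hψ' : ψ ∈ supportedOn {i | dbSize e i ≤ t ∧ dbSize e' i ≤ t} := by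
    intro i hi
    by_cases h1 : dbSize e i ≤ t
    · exact hψ.2 i fun h2 => hi ⟨h1, h2⟩
    · exact hψ.1 i h1
  have key := hL.isBranching.norm_adjoint_apply_le hR.isBranching
    (S := {i | dbSize e i ≤ t ∧ dbSize e' i ≤ t}) (A := 2 ^ n * t) (B := 2 ^ n * (t + 1))
    (c := 2 / 2 ^ (n + lam)) (by positivity) (by positivity) (by positivity)
    (fun i hi => by
      have := weight_sq_le (e := e) (i := i) (by rw [hσ]; have := hi.1; omega)
        (by rw [hσ]; positivity)
      rw [hσ] at this
      exact_mod_cast this)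
    (fun i hi => by
      have h1 := h.card_common_children_le hinj hπ i
      rw [hγ] at h1
      exact_mod_cast h1.trans (Nat.mul_le_mul_left _ hi.2))
    (fun j m hm ⟨i, hi, hmi⟩ => by
      have h1 := dbSize_of_mem_children hm
      have h2 := h.dbSize_eq hmi
      have := weight_sq_le (e := e') (i := j) (by rw [hσ']; have := hi.2; omega)
        (by rw [hσ']; positivity)
      rw [hσ'] at this
      exact_mod_cast this)
    (fun j m hm ⟨i, hi, hmi⟩ => by
      have h1 := dbSize_of_mem_children hmi
      have h2 := h'.dbSize_eq hm
      have h3 := h'.card_common_children_le hinj' (fun m => (hπ m).symm) j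
      rw [hγ'] at h3
      have h4 : dbSize e j ≤ t + 1 := by have := hi.1; omega
      have h5 : {m ∈ children e' j | ∃ i ∈ {i | dbSize e i ≤ t ∧ dbSize e' i ≤ t},
          m ∈ children e i}.card ≤ {m ∈ children e' j | ∃ i, m ∈ children e i}.card :=
        Finset.card_le_card fun x hx => by
          obtain ⟨hx1, i, -, hx2⟩ := Finset.mem_filter.1 hx
          exact Finset.mem_filter.2 ⟨hx1, i, hx2⟩
      exact_mod_cast h5.trans (h3.trans (Nat.mul_le_mul_left _ h4)))
    hψ'
  refine key.trans (mul_le_mul_of_nonneg_right ?_ (norm_nonneg _))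
  have hsqrt : Real.sqrt (2 ^ n * t * (2 ^ n * (t + 1))) ≤ 2 ^ n * (2 * t) := by
    refine Real.sqrt_le_iff.2 ⟨by positivity, ?_⟩
    have ht2 : (t : ℝ) ≤ t * t := by exact_mod_cast Nat.le_mul_self t
    have hn : (0 : ℝ) ≤ (2 ^ n) ^ 2 := by positivity
    nlinarith [mul_le_mul_of_nonneg_left ht2 hn]
  calc 2 / 2 ^ (n + lam) * Real.sqrt (2 ^ n * t * (2 ^ n * (t + 1)))
      ≤ 2 / 2 ^ (n + lam) * (2 ^ n * (2 * t)) :=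
        mul_le_mul_of_nonneg_left hsqrt (by positivity)
    _ = 4 * t / 2 ^ lam := by
        rw [pow_add]
        field_simp
        ring

end PathRecording


/-! ### The three systems of the gluing construction -/

section Systems

/-- Relations on the label set `σ`. -/
abbrev Database (σ : Type) := Multiset (σ × σ)

/-- System 1 acts on the registers `AB` and the databases `(L₁, R₁)`. -/
def sysOne (n lam : ℕ) : GluedIdx n lam ≃
    (BS n × BS lam) × Database (BS n × BS lam) × Database (BS n × BS lam) ×
      BS n × (Database (BS lam × BS n) × Database (BS lam × BS n)) ×
        (Database (BS n × BS lam) × Database (BS n × BS lam)) where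
  toFun i := ((i.1.1, i.1.2.1), i.2.1.1, i.2.1.2, (i.1.2.2, i.2.2.1, i.2.2.2))
  invFun x := ((x.1.1, x.1.2, x.2.2.2.1), (x.2.1, x.2.2.1), x.2.2.2.2.1, x.2.2.2.2.2)
  left_inv _ := rfl
  right_inv _ := rfl

/-- System 2 acts on the registers `BC` and the databases `(L₂, R₂)`. -/
def sysTwo (n lam : ℕ) : GluedIdx n lam ≃
    (BS lam × BS n) × Database (BS lam × BS n) × Database (BS lam × BS n) ×
      BS n × (Database (BS n × BS lam) × Database (BS n × BS lam)) ×
        (Database (BS n × BS lam) × Database (BS n × BS lam)) where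
  toFun i := ((i.1.2.1, i.1.2.2), i.2.2.1.1, i.2.2.1.2, (i.1.1, i.2.1, i.2.2.2))
  invFun x := ((x.2.2.2.1, x.1.1, x.1.2), x.2.2.2.2.1, (x.2.1, x.2.2.1), x.2.2.2.2.2)
  left_inv _ := rfl
  right_inv _ := rfl

/-- System 3 acts on the registers `AB` and the databases `(L₃, R₃)`. -/
def sysThree (n lam : ℕ) : GluedIdx n lam ≃
    (BS n × BS lam) × Database (BS n × BS lam) × Database (BS n × BS lam) ×
      BS n × (Database (BS n × BS lam) × Database (BS n × BS lam)) ×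
        (Database (BS lam × BS n) × Database (BS lam × BS n)) where
  toFun i := ((i.1.1, i.1.2.1), i.2.2.2.1, i.2.2.2.2, (i.1.2.2, i.2.1, i.2.2.1))
  invFun x := ((x.1.1, x.1.2, x.2.2.2.1), x.2.2.2.2.1, x.2.2.2.2.2, (x.2.1, x.2.2.1))
  left_inv _ := rfl
  right_inv _ := rfl

variable {n lam : ℕ}

theorem card_BS (k : ℕ) : Fintype.card (BS k) = 2 ^ k := by simp

theorem card_AB : Fintype.card (BS n × BS lam) = 2 ^ (n + lam) := by simp [pow_add]

theorem card_BC : Fintype.card (BS lam × BS n) = 2 ^ (n + lam) := by simp [pow_add, mul_comm]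

/-- The normalization of the path-recording operators as the amplitude `weight`. -/
theorem coe_weight {ι σ ρ : Type} [Fintype σ] [DecidableEq σ]
    (e : ι ≃ σ × Multiset (σ × σ) × Multiset (σ × σ) × ρ) {k : ℕ}
    (hσ : Fintype.card σ = 2 ^ k) (i : ι) :
    (weight e i : ℂ) = (↑(Real.sqrt ((2 : ℝ) ^ k - (blocked e i).card)) : ℂ)⁻¹ := by
  rw [weight, hσ, Complex.ofReal_inv]
  norm_cast

theorem IsVL1.isPathRecording {V : GOp n lam} (hV : IsVL1 V) :
    IsPathRecording (sysOne n lam) V := fun i => by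
  rw [coe_weight _ card_AB]
  exact hV _ _ _ _ _ _ _ _ _

theorem IsVR1.isPathRecording {V : GOp n lam} (hV : IsVR1 V) :
    IsPathRecording ((sysOne n lam).trans (swapDB _ _)) V := fun i => by
  rw [coe_weight _ card_AB]
  exact hV _ _ _ _ _ _ _ _ _

theorem IsVL2.isPathRecording {V : GOp n lam} (hV : IsVL2 V) :
    IsPathRecording (sysTwo n lam) V := fun i => by
  rw [coe_weight _ card_BC]
  exact hV _ _ _ _ _ _ _ _ _

theorem IsVR2.isPathRecording {V : GOp n lam} (hV : IsVR2 V) :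
    IsPathRecording ((sysTwo n lam).trans (swapDB _ _)) V := fun i => by
  rw [coe_weight _ card_BC]
  exact hV _ _ _ _ _ _ _ _ _

theorem IsVL3.isPathRecording {V : GOp n lam} (hV : IsVL3 V) :
    IsPathRecording (sysThree n lam) V := fun i => by
  rw [coe_weight _ card_AB]
  exact hV _ _ _ _ _ _ _ _ _

theorem IsVR3.isPathRecording {V : GOp n lam} (hV : IsVR3 V) :
    IsPathRecording ((sysThree n lam).trans (swapDB _ _)) V := fun i => by
  rw [coe_weight _ card_AB]
  exact hV _ _ _ _ _ _ _ _ _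

theorem independentDB_one_two : IndependentDB (sysOne n lam) (sysTwo n lam) :=
  fun _ _ h => Prod.mk.inj (congrArg (fun r => r.2.1) h)

theorem independentDB_one_three : IndependentDB (sysOne n lam) (sysThree n lam) :=
  fun _ _ h => Prod.mk.inj (congrArg (fun r => r.2.2) h)

theorem independentDB_two_one : IndependentDB (sysTwo n lam) (sysOne n lam) :=
  fun _ _ h => Prod.mk.inj (congrArg (fun r => r.2.1) h)

theorem independentDB_two_three : IndependentDB (sysTwo n lam) (sysThree n lam) :=
  fun _ _ h => Prod.mk.inj (congrArg (fun r => r.2.2) h)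

theorem independentDB_three_one : IndependentDB (sysThree n lam) (sysOne n lam) :=
  fun _ _ h => Prod.mk.inj (congrArg (fun r => r.2.1) h)

theorem independentDB_three_two : IndependentDB (sysThree n lam) (sysTwo n lam) :=
  fun _ _ h => Prod.mk.inj (congrArg (fun r => r.2.2) h)

theorem IsPt.isBranching {t : ℕ} {P : GOp n lam} (hP : IsPt t P) :
    IsBranching P (fun _ => 1) fun i =>
      if dbSize (sysOne n lam) i + dbSize (sysTwo n lam) i + dbSize (sysThree n lam) i ≤ t
        then {i} else ∅ where
  apply_ket i := by
    refine (hP _ _ _ _ _ _ _).trans ?_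
    simp only [dbSize, sysOne, sysTwo, sysThree, Equiv.coe_fn_mk, ← add_assoc]
    split_ifs <;> simp
  parent_unique {i j m} hi hj := by
    split_ifs at hi hj <;> simp_all
  weight_le i := by
    split_ifs <;> simp

theorem IsPt.apply_mem {t : ℕ} {P : GOp n lam} (hP : IsPt t P) (ψ : QState (GluedIdx n lam)) :
    P ψ ∈ supportedOn {i | dbSize (sysOne n lam) i ≤ t} ∧
    P ψ ∈ supportedOn {i | dbSize (sysTwo n lam) i ≤ t} ∧
    P ψ ∈ supportedOn {i | dbSize (sysThree n lam) i ≤ t} := by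
  have key : ∀ m, (P ψ) m ≠ 0 →
      dbSize (sysOne n lam) m + dbSize (sysTwo n lam) m + dbSize (sysThree n lam) m ≤ t := by
    intro m hm
    obtain ⟨i, hi, -⟩ := hP.isBranching.exists_parent hm
    split_ifs at hi with h
    · rwa [Finset.mem_singleton.1 hi]
    · simp at hi
  refine ⟨fun m hm => ?_, fun m hm => ?_, fun m hm => ?_⟩ <;>
  · by_contra h0
    have := key m h0
    exact hm (by simp only [Set.mem_ofPred_eq]; omega)

theorem norm_cross_one_two_le {L R : GOp n lam} (hL : IsVL1 L) (hR : IsVR2 R) {t : ℕ}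
    (ht : 2 * t ≤ 2 ^ lam) (ψ : QState (GluedIdx n lam))
    (hψ : ψ ∈ supportedOn {i | dbSize (sysOne n lam) i ≤ t} ⊓
      supportedOn {i | dbSize (sysTwo n lam) i ≤ t}) :
    ‖ContinuousLinearMap.adjoint R (L ψ)‖ ≤ 4 * t / 2 ^ lam * ‖ψ‖ :=
  norm_cross_term_le independentDB_one_two.swap_right independentDB_two_one.swap_left
    (π := Prod.snd) (κ := Prod.fst) (fun _ _ h => Prod.swap_injective h)
    (π' := Prod.fst) (κ' := Prod.snd) (fun _ _ h => h) (fun _ => rfl)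
    hL.isPathRecording hR.isPathRecording (card_BS n) (card_BS n) card_AB card_BC ht
    (by simpa only [dbSize_swap] using hψ)

theorem norm_cross_two_three_le {L R : GOp n lam} (hL : IsVL2 L) (hR : IsVR3 R) {t : ℕ}
    (ht : 2 * t ≤ 2 ^ lam) (ψ : QState (GluedIdx n lam))
    (hψ : ψ ∈ supportedOn {i | dbSize (sysTwo n lam) i ≤ t} ⊓
      supportedOn {i | dbSize (sysThree n lam) i ≤ t}) :
    ‖ContinuousLinearMap.adjoint R (L ψ)‖ ≤ 4 * t / 2 ^ lam * ‖ψ‖ :=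
  norm_cross_term_le independentDB_two_three.swap_right independentDB_three_two.swap_left
    (π := Prod.fst) (κ := Prod.snd) (fun _ _ h => h)
    (π' := Prod.snd) (κ' := Prod.fst) (fun _ _ h => Prod.swap_injective h) (fun _ => rfl)
    hL.isPathRecording hR.isPathRecording (card_BS n) (card_BS n) card_BC card_AB ht
    (by simpa only [dbSize_swap] using hψ)

end Systems

/-- **The glued path-recording operator is close to the composition of three
path-recording operators.**  There is a universal constant `C > 0` such that
for all `n, λ, t` and all path-recording operators
`V_L^i, V_R^i` (`i = 1,2,3`) of the three systems, with
`Vⁱ = V_Lⁱ (I − V_Rⁱ V_R^{i,†}) + (I − V_Lⁱ V_L^{i,†}) V_R^{i,†}`,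
`‖ (V^{glued} − V³ V² V¹) Π_{≤t} ‖ ≤ C · t² / 2^λ`. -/
theorem glued_path_recording_close_to_composition :
    ∃ C : ℝ, 0 < C ∧
      ∀ (n lam t : ℕ) (VL1 VR1 VL2 VR2 VL3 VR3 Pt : GOp n lam),
        IsVL1 VL1 → IsVR1 VR1 → IsVL2 VL2 → IsVR2 VR2 → IsVL3 VL3 → IsVR3 VR3 →
        IsPt t Pt →
        ‖(gluedOp VL1 VR1 VL2 VR2 VL3 VR3 -
            prV VL3 VR3 * prV VL2 VR2 * prV VL1 VR1) * Pt‖ ≤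
          C * (t : ℝ) ^ 2 / 2 ^ lam := by
  refine ⟨304, by norm_num, fun n lam t VL1 VR1 VL2 VR2 VL3 VR3 Pt hL1 hR1 hL2 hR2 hL3 hR3 hP => ?_⟩
  have hPt : ∀ ψ, ‖Pt ψ‖ ≤ ‖ψ‖ := norm_apply_le_of_norm_le_one hP.isBranching.norm_le_one
  have htt : (t : ℝ) ≤ t ^ 2 := by exact_mod_cast Nat.le_self_pow two_ne_zero t
  have hL1' := hL1.isPathRecording
  have hR1' := hR1.isPathRecording
  have hL2' := hL2.isPathRecording
  have hR2' := hR2.isPathRecording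
  have hL3' := hL3.isPathRecording
  have hR3' := hR3.isPathRecording
  refine ContinuousLinearMap.opNorm_le_bound _ (by positivity) fun ψ => ?_
  rw [mul_apply_eq_comp]
  rcases le_or_gt (2 * t) (2 ^ lam) with ht | ht
  · have htN : t < 2 ^ (n + lam) := by
      have h1 : 2 ^ lam ≤ 2 ^ (n + lam) := Nat.pow_le_pow_right two_pos (Nat.le_add_left _ _)
      have h2 : 0 < 2 ^ (n + lam) := by positivity
      omega
    obtain ⟨hP1, hP2, hP3⟩ := hP.apply_mem ψ
    have main := norm_gluedOp_sub_comp_apply_le (ε := 4 * t / 2 ^ lam) (by positivity)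
      (hL1'.isometricPair hR1' (card_AB ▸ htN)) (hL2'.isometricPair hR2' (card_BC ▸ htN))
      (hL3'.isometricPair hR3' (card_AB ▸ htN))
      (independentDB_two_one.preservesPair hL2' hR2' t)
      (independentDB_three_one.preservesPair hL3' hR3' t)
      (independentDB_one_two.preservesPair hL1' hR1' t)
      (independentDB_three_two.preservesPair hL3' hR3' t)
      (independentDB_one_three.preservesPair hL1' hR1' t)
      (independentDB_two_three.preservesPair hL2' hR2' t)
      (norm_cross_one_two_le hL1 hR2 ht) (norm_cross_two_three_le hL2 hR3 ht) hP1 hP2 hP3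
    calc _ ≤ 76 * (4 * t / 2 ^ lam) * ‖Pt ψ‖ := main
      _ = 304 * t / 2 ^ lam * ‖Pt ψ‖ := by ring
      _ ≤ 304 * t ^ 2 / 2 ^ lam * ‖ψ‖ := by
          gcongr
          exact hPt ψ
  · have main := norm_gluedOp_sub_comp_le hL1'.isBranching.norm_le_one
      hR1'.isBranching.norm_le_one hL2'.isBranching.norm_le_one hR2'.isBranching.norm_le_one
      hL3'.isBranching.norm_le_one hR3'.isBranching.norm_le_one
    have ht' : (2 : ℝ) ^ lam < 2 * t := by exact_mod_cast ht
    have hC : (80 : ℝ) ≤ 304 * t ^ 2 / 2 ^ lam := by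
      rw [le_div_iff₀ (by positivity)]
      linarith
    calc _ ≤ 80 * ‖Pt ψ‖ := ContinuousLinearMap.le_of_opNorm_le _ main _
      _ ≤ 304 * t ^ 2 / 2 ^ lam * ‖ψ‖ := mul_le_mul hC (hPt ψ) (norm_nonneg _) (by positivity)
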